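/- Let X and Y be Banach spaces and μ0 a Borel probability measure on X. Let Φ : X × Y → ℝ be such that Φ(·;y) is Borel measurable for each y and: (i) there is a nondecreasing function f1 : [0,∞) → [1,∞) such that for every r > 0 there is M(r) ∈ ℝ with Φ(u;y) ≥ M(r) − log f1(‖u‖_X) for all u ∈ X and all y ∈ B_Y(r); (iv) there is a nondecreasing function f2 : [0,∞) → [0,∞) such that for every r > 0 there is C(r) > 0 with |Φ(u;y1) − Φ(u;y2)| ≤ C(r) f2(‖u‖_X) ‖y1 − y2‖_Y for all y1, y2 ∈ B_Y(r) and all u ∈ X. If u ↦ f1(‖u‖_X) f2(‖u‖_X) is integrable with respect to μ0, then for every r > 0 the normalizing constant Z(y) = ∫_X exp(−Φ(u;y)) dμ0(u) satisfies |Z(y) − Z(y')| ≤ C(r) e^{−M(r)} ( ∫_X f1(‖u‖_X) f2(‖u‖_X) dμ0(u) ) ‖y − y'‖_Y for all y, y' ∈ B_Y(r). -/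

import Mathlib

open MeasureTheory Real

theorem abs_exp_neg_sub_exp_neg_le {a b c : ℝ} (ha : c ≤ a) (hb : c ≤ b) :
    |exp (-a) - exp (-b)| ≤ exp (-c) * |a - b| := by
  wlog hab : a ≤ b generalizing a b
  · rw [abs_sub_comm, abs_sub_comm a]
    exact this hb ha (le_of_not_ge hab)
  have hle : exp (-b) ≤ exp (-a) := exp_le_exp.2 (neg_le_neg hab)
  have hfactor : exp (-b) = exp (-a) * exp (a - b) := by
    rw [← exp_add]
    ring_nf
  rw [abs_of_nonneg (sub_nonneg.2 hle), abs_sub_comm, abs_of_nonneg (sub_nonneg.2 hab)]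
  calc exp (-a) - exp (-b) = exp (-a) * (1 - exp (a - b)) := by rw [hfactor]; ring
    _ ≤ exp (-a) * (b - a) :=
        mul_le_mul_of_nonneg_left (by linarith [add_one_le_exp (a - b)]) (exp_pos _).le
    _ ≤ exp (-c) * (b - a) := by
        have := sub_nonneg.2 hab
        gcongr

/-- No integrability of `f` or `g` is needed: if one of them is not integrable then neither is
the other, and both integrals vanish. -/
theorem abs_integral_sub_integral_le_of_abs_sub_le {α : Type*} [MeasurableSpace α]
    {μ : Measure α} {f g h : α → ℝ} (hf : AEStronglyMeasurable f μ)
    (hg : AEStronglyMeasurable g μ) (hh : Integrable h μ) (hle : ∀ x, |f x - g x| ≤ h x) :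
    |(∫ x, f x ∂μ) - ∫ x, g x ∂μ| ≤ ∫ x, h x ∂μ := by
  have hsub : Integrable (fun x => f x - g x) μ :=
    hh.mono' (hf.sub hg) (ae_of_all μ hle)
  by_cases hfi : Integrable f μ
  · have hgi : Integrable g μ := by simpa using hfi.sub' hsub
    rw [← integral_sub hfi hgi]
    exact norm_integral_le_of_norm_le (f := fun x => f x - g x) hh (ae_of_all μ hle)
  · have hgi : ¬ Integrable g μ := fun hgi =>
      hfi ((hsub.add hgi).congr (ae_of_all μ fun x => sub_add_cancel (f x) (g x)))
    rw [integral_undef hfi, integral_undef hgi, sub_zero, abs_zero]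
    exact integral_nonneg fun x => (abs_nonneg _).trans (hle x)

/-- Explicit Lipschitz bound on the normalizing constant: under
Assumptions (i) and (iv) with constants `M(r)` and `C(r)`, and integrability of
`f1(‖u‖) f2(‖u‖)` w.r.t. the prior,
`|Z(y) − Z(y')| ≤ C(r) e^{−M(r)} (∫ f1(‖u‖) f2(‖u‖) dμ0) ‖y − y'‖` for all
`y, y' ∈ B_Y(r)`. -/
theorem normalizing_constant_lipschitz
    {X Y : Type*} [NormedAddCommGroup X] [NormedSpace ℝ X] [CompleteSpace X]
    [MeasurableSpace X] [BorelSpace X]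
    [NormedAddCommGroup Y] [NormedSpace ℝ Y] [CompleteSpace Y]
    (μ0 : Measure X) [IsProbabilityMeasure μ0]
    (Φ : X → Y → ℝ)
    (hmeas : ∀ y : Y, Measurable (fun u => Φ u y))
    (f1 f2 : ℝ → ℝ)
    (hf1_mono : MonotoneOn f1 (Set.Ici 0))
    (hf1_ge : ∀ t : ℝ, 0 ≤ t → 1 ≤ f1 t)
    (hf2_mono : MonotoneOn f2 (Set.Ici 0))
    (hf2_nonneg : ∀ t : ℝ, 0 ≤ t → 0 ≤ f2 t)
    (hint : Integrable (fun u => f1 ‖u‖ * f2 ‖u‖) μ0) :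
    ∀ r > 0, ∀ M : ℝ, ∀ C : ℝ, 0 < C →
      (∀ u : X, ∀ y : Y, ‖y‖ < r → M - Real.log (f1 ‖u‖) ≤ Φ u y) →
      (∀ u : X, ∀ y1 y2 : Y, ‖y1‖ < r → ‖y2‖ < r →
        |Φ u y1 - Φ u y2| ≤ C * f2 ‖u‖ * ‖y1 - y2‖) →
      ∀ y y' : Y, ‖y‖ < r → ‖y'‖ < r →
        |(∫ u, Real.exp (-(Φ u y)) ∂μ0) - ∫ u, Real.exp (-(Φ u y')) ∂μ0|
          ≤ C * Real.exp (-M) * (∫ u, f1 ‖u‖ * f2 ‖u‖ ∂μ0) * ‖y - y'‖ := by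
  intro r _ M C _ hlower hlip y y' hy hy'
  have hmeas_exp (z : Y) : AEStronglyMeasurable (fun u => exp (-(Φ u z))) μ0 :=
    (hmeas z).neg.exp.aestronglyMeasurable
  have hbound (u : X) : |exp (-(Φ u y)) - exp (-(Φ u y'))| ≤
      C * exp (-M) * (f1 ‖u‖ * f2 ‖u‖) * ‖y - y'‖ := by
    have hf1 : 0 < f1 ‖u‖ := zero_lt_one.trans_le (hf1_ge _ (norm_nonneg u))
    calc |exp (-(Φ u y)) - exp (-(Φ u y'))|
        ≤ exp (-(M - log (f1 ‖u‖))) * |Φ u y - Φ u y'| :=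
          abs_exp_neg_sub_exp_neg_le (hlower u y hy) (hlower u y' hy')
      _ ≤ exp (-(M - log (f1 ‖u‖))) * (C * f2 ‖u‖ * ‖y - y'‖) := by
          gcongr
          exact hlip u y y' hy hy'
      _ = C * exp (-M) * (f1 ‖u‖ * f2 ‖u‖) * ‖y - y'‖ := by
          rw [neg_sub, sub_eq_add_neg, exp_add, exp_log hf1]
          ring
  calc _ ≤ ∫ u, C * exp (-M) * (f1 ‖u‖ * f2 ‖u‖) * ‖y - y'‖ ∂μ0 :=
        abs_integral_sub_integral_le_of_abs_sub_le (hmeas_exp y) (hmeas_exp y')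
          ((hint.const_mul _).mul_const _) hbound
    _ = _ := by rw [integral_mul_const, integral_const_mul]
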